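/- Let M be a σ-compact, non-compact, connected 2-manifold (possibly with boundary). If M contains a handle, i.e., there is a compact subsurface of M homeomorphic to the torus S¹ × S¹ with an open disk removed, then the mapping class group 𝓜_c(M) = 𝓗_c(M)/𝓗₀(M) contains an element of infinite order (hence an infinite cyclic subgroup). -/

import Mathlib

noncomputable section

open scoped Pointwise

/-- The Whitney topology on the homeomorphism group of a space `M`:
it is generated by the sets `{f | graph f ⊆ U}` where `U` runs over the open subsets
of `M × M`. -/
def whitneyTopology (M : Type*) [TopologicalSpace M] : TopologicalSpace (M ≃ₜ M) :=
  TopologicalSpace.generateFrom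
    {S : Set (M ≃ₜ M) | ∃ U : Set (M × M), IsOpen U ∧ S = {f : M ≃ₜ M | ∀ x : M, (x, f x) ∈ U}}

/-- We endow the homeomorphism group `𝓗(M)` with the Whitney topology. -/
instance (M : Type*) [TopologicalSpace M] : TopologicalSpace (M ≃ₜ M) := whitneyTopology M

/-- `𝓗_c(M)`: the set of compactly supported homeomorphisms of `M`. -/
def Hc (M : Type*) [TopologicalSpace M] : Set (M ≃ₜ M) :=
  {f : M ≃ₜ M | IsCompact (closure {x : M | f x ≠ x})}

/-- `𝓗₀(M)`: the identity component of the homeomorphism group of `M` with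
the Whitney topology. -/
def H0 (M : Type*) [TopologicalSpace M] : Set (M ≃ₜ M) :=
  connectedComponent (Homeomorph.refl M)

/-- The `n`-th power (iterate) of a self-homeomorphism. -/
def hpow {M : Type*} [TopologicalSpace M] (h : M ≃ₜ M) : ℕ → (M ≃ₜ M)
  | 0 => Homeomorph.refl M
  | n + 1 => (hpow h n).trans h

/-- The torus `S¹ × S¹`, realized as `(ℝ/ℤ) × (ℝ/ℤ)`. -/
def Torus : Type := AddCircle (1 : ℝ) × AddCircle (1 : ℝ)

instance : TopologicalSpace Torus :=
  inferInstanceAs (TopologicalSpace (AddCircle (1 : ℝ) × AddCircle (1 : ℝ)))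

/-- The covering projection `ℝ² → S¹ × S¹`. -/
def torusProj (q : EuclideanSpace ℝ (Fin 2)) : Torus :=
  ((q 0 : AddCircle (1 : ℝ)), (q 1 : AddCircle (1 : ℝ)))

/-- An embedded open disk in the torus. -/
def torusDisk : Set Torus := torusProj '' Metric.ball (0 : EuclideanSpace ℝ (Fin 2)) (1 / 4)

/-- The torus with an open disk removed. -/
def TorusWithHole : Type := {p : Torus // p ∉ torusDisk}

instance : TopologicalSpace TorusWithHole :=
  inferInstanceAs (TopologicalSpace {p : Torus // p ∉ torusDisk})


open Set Topology Metric

/-- A complex-valued function has a continuous logarithm. -/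
def HasLog {X : Type*} [TopologicalSpace X] (u : X → ℂ) : Prop :=
  ∃ L : X → ℂ, Continuous L ∧ ∀ x, Complex.exp (L x) = u x

namespace HasLog

variable {X : Type*} [TopologicalSpace X] {u v : X → ℂ}

theorem ne_zero (hu : HasLog u) (x : X) : u x ≠ 0 := by
  obtain ⟨L, -, h⟩ := hu
  rw [← h]
  exact Complex.exp_ne_zero _

theorem mul (hu : HasLog u) (hv : HasLog v) : HasLog fun x => u x * v x := by
  obtain ⟨L, hL, h⟩ := hu
  obtain ⟨K, hK, k⟩ := hv
  exact ⟨fun x => L x + K x, hL.add hK, fun x => by rw [Complex.exp_add, h, k]⟩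

theorem const {c : ℂ} (hc : c ≠ 0) : HasLog fun _ : X => c :=
  ⟨fun _ => Complex.log c, continuous_const, fun _ => Complex.exp_log hc⟩

theorem of_mem_slitPlane (hu : Continuous u) (h : ∀ x, u x ∈ Complex.slitPlane) : HasLog u :=
  ⟨fun x => Complex.log (u x), hu.clog h,
    fun x => Complex.exp_log (Complex.slitPlane_ne_zero (h x))⟩

theorem of_div_mem_slitPlane (hu : HasLog u) (hc : Continuous u) (hv : Continuous v)
    (h : ∀ x, v x / u x ∈ Complex.slitPlane) : HasLog v := by
  have := (of_mem_slitPlane (hv.div hc hu.ne_zero) h).mul hu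
  simpa [div_mul_cancel₀ _ (hu.ne_zero _)] using this

theorem comp {Y : Type*} [TopologicalSpace Y] (hu : HasLog u) {g : Y → X} (hg : Continuous g) :
    HasLog (u ∘ g) := by
  obtain ⟨L, hL, h⟩ := hu
  exact ⟨L ∘ g, hL.comp hg, fun y => h (g y)⟩

/-- On a compact space, having a continuous logarithm is invariant under homotopies through
nowhere vanishing functions. -/
theorem of_homotopy [CompactSpace X] {H : unitInterval → X → ℂ}
    (hH : Continuous (Function.uncurry H)) (h0 : ∀ t x, H t x ≠ 0) (s t : unitInterval)
    (hs : HasLog (H s)) : HasLog (H t) := by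
  have hcont : ∀ t, Continuous (H t) := fun t => hH.comp (Continuous.prodMk_right t)
  have key : ∀ s, ∀ᶠ t in 𝓝 s, ∀ x ∈ (univ : Set X), H t x / H s x ∈ Complex.slitPlane := by
    intro s
    refine isCompact_univ.eventually_forall_of_forall_eventually fun x _ => ?_
    have hc : Continuous fun z : unitInterval × X => H z.1 z.2 / H s z.2 :=
      hH.div ((hcont s).comp continuous_snd) fun z => h0 _ _
    refine hc.continuousAt.eventually (Complex.isOpen_slitPlane.mem_nhds ?_)
    simp [div_self (h0 s x)]
  have hinv : ∀ {z : ℂ}, z ∈ Complex.slitPlane → z⁻¹ ∈ Complex.slitPlane := by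
    intro z hz
    have hpos : 0 < Complex.normSq z := Complex.normSq_pos.2 (Complex.slitPlane_ne_zero hz)
    rw [Complex.mem_slitPlane_iff] at hz ⊢
    rw [Complex.inv_re, Complex.inv_im]
    exact hz.imp (fun h => div_pos h hpos) fun h => div_ne_zero (neg_ne_zero.2 h) hpos.ne'
  have hclopen : IsClopen {t | HasLog (H t)} := by
    refine ⟨?_, ?_⟩
    · rw [← isOpen_compl_iff, isOpen_iff_mem_nhds]
      intro a ha
      filter_upwards [key a] with b hb hlog
      refine ha (hlog.of_div_mem_slitPlane (hcont b) (hcont a) fun x => ?_)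
      simpa using hinv (hb x trivial)
    · rw [isOpen_iff_mem_nhds]
      intro a ha
      filter_upwards [key a] with b hb
      exact HasLog.of_div_mem_slitPlane ha (hcont a) (hcont b) fun x => hb x trivial
  exact (hclopen.eq_univ ⟨s, hs⟩ ▸ mem_univ t : t ∈ {t | HasLog (H t)})

/-- A nowhere vanishing function on the closed unit disk has a continuous logarithm. -/
theorem of_closedBall {f : ℂ → ℂ} (hf : ContinuousOn f (closedBall 0 1))
    (h0 : ∀ z ∈ closedBall (0 : ℂ) 1, f z ≠ 0) : HasLog fun z : closedBall (0 : ℂ) 1 => f z := by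
  have : CompactSpace (closedBall (0 : ℂ) 1) :=
    isCompact_iff_compactSpace.1 (isCompact_closedBall _ _)
  have hmem : ∀ (t : unitInterval) (z : closedBall (0 : ℂ) 1), (t : ℝ) * (z : ℂ) ∈
      closedBall (0 : ℂ) 1 := by
    intro t z
    have := z.2
    simp only [mem_closedBall, dist_zero_right, norm_mul, Complex.norm_real, Real.norm_eq_abs,
      abs_of_nonneg t.2.1] at this ⊢
    exact mul_le_one₀ t.2.2 (norm_nonneg _) this
  have h1 := of_homotopy (H := fun t (z : closedBall (0 : ℂ) 1) => f ((t : ℝ) * (z : ℂ)))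
    (hf.comp_continuous (by fun_prop) fun p => hmem p.1 p.2) (fun t z => h0 _ (hmem t z)) 0 1
    (by simpa using const (h0 0 (by simp)))
  simpa using h1

end HasLog

/-- An odd function on the unit circle has no continuous logarithm. -/
theorem not_hasLog_of_odd {u : sphere (0 : ℂ) 1 → ℂ} (hu : ∀ x, u (-x) = -u x) : ¬ HasLog u := by
  rintro ⟨L, hL, h⟩
  have hconn : PreconnectedSpace (sphere (0 : ℂ) 1) :=
    isPreconnected_iff_preconnectedSpace.1
      (isPreconnected_sphere (by simp [Complex.rank_real_complex]) _ _)
  have hexp : ∀ x, Complex.exp (L (-x) - L x) = -1 := by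
    intro x
    have hx : u x ≠ 0 := by rw [← h]; exact Complex.exp_ne_zero _
    rw [Complex.exp_sub, h, h, hu, neg_div, div_self hx]
  have hk : ∀ x, ∃ k : ℤ, (L (-x) - L x) = (2 * k + 1) * (Real.pi * Complex.I) := by
    intro x
    have := hexp x
    rw [← Complex.exp_pi_mul_I, Complex.exp_eq_exp_iff_exists_int] at this
    obtain ⟨n, hn⟩ := this
    exact ⟨n, by rw [hn]; ring⟩
  choose k hk using hk
  have hkc : Continuous k := by
    rw [Int.isClosedEmbedding_coe_real.isInducing.continuous_iff]
    have : ((fun n : ℤ => (n : ℝ)) ∘ k) = fun x => ((L (-x) - L x).im / Real.pi - 1) / 2 := by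
      ext x
      rw [hk x]
      simp [Real.pi_ne_zero]
    rw [this]
    have := hL.comp (continuous_neg (G := sphere (0 : ℂ) 1))
    simp only [Function.comp_def] at this
    fun_prop
  let x : sphere (0 : ℂ) 1 := ⟨1, by simp⟩
  have heq : k (-x) = k x := PreconnectedSpace.constant hconn hkc
  have h1 := hk x
  have h2 := hk (-x)
  rw [neg_neg, heq] at h2
  have h3 : ((2 * k x + 1 : ℤ) : ℂ) * (Real.pi * Complex.I) = 0 := by
    push_cast
    linear_combination (-(h1 + h2)) / 2
  have : (2 * k x + 1 : ℤ) = 0 := by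
    have hpi : (Real.pi * Complex.I : ℂ) ≠ 0 := by simp [Real.pi_ne_zero]
    exact_mod_cast (mul_eq_zero.1 h3).resolve_right hpi
  omega

/-- The winding number of an injective plane map along the unit circle, about the image of the
centre, is nonzero. -/
theorem not_hasLog_sub_of_injOn {f : ℂ → ℂ} (hf : ContinuousOn f (closedBall 0 1))
    (hinj : InjOn f (closedBall 0 1)) :
    ¬ HasLog fun z : sphere (0 : ℂ) 1 => f z - f 0 := by
  intro hlog
  have : CompactSpace (sphere (0 : ℂ) 1) := isCompact_iff_compactSpace.1 (isCompact_sphere _ _)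
  have hpos : ∀ t : unitInterval, (0 : ℝ) < 1 + t := fun t => by linarith [t.2.1]
  have hmem₁ : ∀ (t : unitInterval) (z : sphere (0 : ℂ) 1),
      (((1 + t : ℝ)⁻¹ : ℝ) : ℂ) * z ∈ closedBall (0 : ℂ) 1 := by
    intro t z
    simp only [mem_closedBall, dist_zero_right, norm_mul, Complex.norm_real, norm_eq_of_mem_sphere,
      mul_one, Real.norm_eq_abs]
    rw [abs_of_pos (inv_pos.2 (hpos t))]
    exact inv_le_one_of_one_le₀ (by linarith [t.2.1])
  have hmem₂ : ∀ (t : unitInterval) (z : sphere (0 : ℂ) 1),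
      ((-(t * (1 + t : ℝ)⁻¹) : ℝ) : ℂ) * z ∈ closedBall (0 : ℂ) 1 := by
    intro t z
    simp only [mem_closedBall, dist_zero_right, norm_mul, Complex.norm_real, norm_eq_of_mem_sphere,
      mul_one, Real.norm_eq_abs, abs_neg]
    rw [abs_of_nonneg (mul_nonneg t.2.1 (inv_pos.2 (hpos t)).le), ← div_eq_mul_inv,
      div_le_one (hpos t)]
    linarith
  have h1 := HasLog.of_homotopy
    (H := fun t (z : sphere (0 : ℂ) 1) => f ((((1 + t : ℝ)⁻¹ : ℝ) : ℂ) * z) -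
      f (((-(t * (1 + t : ℝ)⁻¹) : ℝ) : ℂ) * z)) ?_ ?_ 0 1 (by simpa using hlog)
  · refine not_hasLog_of_odd (fun x => ?_) h1
    simp only [Set.Icc.coe_one]
    norm_num
  · have hc : Continuous fun p : unitInterval × sphere (0 : ℂ) 1 => (1 + p.1 : ℝ)⁻¹ :=
      Continuous.inv₀ (by fun_prop) fun p => (hpos p.1).ne'
    have hz : Continuous fun p : unitInterval × sphere (0 : ℂ) 1 => (p.2 : ℂ) := by fun_prop
    have ht : Continuous fun p : unitInterval × sphere (0 : ℂ) 1 => (p.1 : ℝ) := by fun_prop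
    have h₁ := (Complex.continuous_ofReal.comp hc).mul hz
    have h₂ := (Complex.continuous_ofReal.comp (ht.mul hc).neg).mul hz
    exact (hf.comp_continuous h₁ fun p => hmem₁ p.1 p.2).sub
      (hf.comp_continuous h₂ fun p => hmem₂ p.1 p.2)
  · intro t z h
    have h2 := hinj (hmem₁ t z) (hmem₂ t z) (sub_eq_zero.1 h)
    have hz : (z : ℂ) ≠ 0 := ne_zero_of_mem_unit_sphere z
    have h3 := Complex.ofReal_injective (mul_right_cancel₀ hz h2)
    have := inv_pos.2 (hpos t)
    have := mul_nonneg t.2.1 this.le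
    linarith

/-- Invariance of domain in the plane. -/
theorem image_closedBall_mem_nhds {f : ℂ → ℂ} (hf : ContinuousOn f (closedBall 0 1))
    (hinj : InjOn f (closedBall 0 1)) : f '' closedBall 0 1 ∈ 𝓝 (f 0) := by
  have hfs : Continuous fun z : sphere (0 : ℂ) 1 => f z :=
    hf.comp_continuous continuous_subtype_val fun z => sphere_subset_closedBall z.2
  have hne : ∀ z : sphere (0 : ℂ) 1, f z - f 0 ≠ 0 := fun z h =>
    ne_zero_of_mem_unit_sphere z
      (hinj (sphere_subset_closedBall z.2) (by simp) (sub_eq_zero.1 h))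
  have hev : ∀ᶠ p in 𝓝 (f 0), ∀ z ∈ (univ : Set (sphere (0 : ℂ) 1)),
      f z - p ≠ 0 ∧ (f z - f 0) / (f z - p) ∈ Complex.slitPlane := by
    have : CompactSpace (sphere (0 : ℂ) 1) := isCompact_iff_compactSpace.1 (isCompact_sphere _ _)
    refine isCompact_univ.eventually_forall_of_forall_eventually fun z _ => ?_
    have h1 : ContinuousAt (fun q : ℂ × sphere (0 : ℂ) 1 => f q.2 - q.1) (f 0, z) := by
      have := hfs.comp (continuous_snd (X := ℂ))
      exact (this.sub continuous_fst).continuousAt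
    have h2 : ContinuousAt (fun q : ℂ × sphere (0 : ℂ) 1 => (f q.2 - f 0) / (f q.2 - q.1))
        (f 0, z) := by
      have := hfs.comp (continuous_snd (X := ℂ))
      exact (this.sub continuous_const).continuousAt.div h1 (hne z)
    refine (h1.eventually_ne (hne z)).and
      (h2.eventually (Complex.isOpen_slitPlane.mem_nhds ?_))
    simp [div_self (hne z)]
  filter_upwards [hev] with p hp
  by_contra hnot
  have h0 : ∀ z ∈ closedBall (0 : ℂ) 1, f z - p ≠ 0 := fun z hz h =>
    hnot ⟨z, hz, sub_eq_zero.1 h⟩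
  have h1 := (HasLog.of_closedBall (hf.sub continuousOn_const) h0).comp
    (continuous_inclusion (sphere_subset_closedBall (x := (0 : ℂ)) (ε := 1)))
  refine not_hasLog_sub_of_injOn hf hinj
    (h1.of_div_mem_slitPlane (hfs.sub continuous_const) (hfs.sub continuous_const)
      fun z => (hp z trivial).2)

/-- The inclusion of the Euclidean half-plane into the complex plane. -/
def halfPlaneToComplex (x : EuclideanHalfSpace 2) : ℂ := ⟨x.1 0, x.1 1⟩

theorem continuous_halfPlaneToComplex : Continuous halfPlaneToComplex := by
  have h : Continuous fun x : EuclideanHalfSpace 2 => x.1 := continuous_subtype_val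
  have h0 : Continuous fun x : EuclideanHalfSpace 2 => x.1 0 := by fun_prop
  have h1 : Continuous fun x : EuclideanHalfSpace 2 => x.1 1 := by fun_prop
  have := Complex.equivRealProdCLM.symm.continuous.comp (h0.prodMk h1)
  exact this

theorem halfPlaneToComplex_injective : Function.Injective halfPlaneToComplex := by
  intro x y h
  have h0 := congrArg Complex.re h
  have h1 := congrArg Complex.im h
  refine EuclideanHalfSpace.ext x y ?_
  ext i
  fin_cases i
  · exact h0
  · exact h1

theorem real_mul_mem_closedBall {r : ℝ} (hr : 0 < r) {w : ℂ} (hw : w ∈ closedBall (0 : ℂ) 1) :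
    (r : ℂ) * w ∈ closedBall (0 : ℂ) r := by
  simp only [mem_closedBall, dist_zero_right, norm_mul, Complex.norm_real, Real.norm_eq_abs,
    abs_of_pos hr] at hw ⊢
  nlinarith

/-- Invariance of domain in a topological surface. -/
theorem image_closedBall_mem_nhds_of_chartedSpace {M : Type*} [TopologicalSpace M]
    [ChartedSpace (EuclideanHalfSpace 2) M] {E : ℂ → M}
    (hE : ContinuousOn E (closedBall 0 1)) (hinj : InjOn E (closedBall 0 1)) :
    E '' closedBall 0 1 ∈ 𝓝 (E 0) := by
  let c := chartAt (EuclideanHalfSpace 2) (E 0)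
  have hsrc : c.source ∈ 𝓝 (E 0) := chart_source_mem_nhds _ _
  have h0 : ContinuousAt E 0 := hE.continuousAt (closedBall_mem_nhds _ one_pos)
  obtain ⟨r, hr, hrs⟩ := Metric.nhds_basis_closedBall.mem_iff.1
    (Filter.inter_mem (h0 hsrc) (closedBall_mem_nhds (0 : ℂ) one_pos))
  have hinjc : InjOn (halfPlaneToComplex ∘ c) c.source :=
    halfPlaneToComplex_injective.comp_injOn c.injOn
  have hcc : ContinuousOn (halfPlaneToComplex ∘ c) c.source :=
    continuous_halfPlaneToComplex.comp_continuousOn c.continuousOn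
  have hmaps : MapsTo (fun w : ℂ => E (r * w)) (closedBall 0 1) c.source :=
    fun w hw => (hrs (real_mul_mem_closedBall hr hw)).1
  have hEs : ContinuousOn (fun w : ℂ => E (r * w)) (closedBall 0 1) :=
    hE.comp (by fun_prop) fun w hw => (hrs (real_mul_mem_closedBall hr hw)).2
  have hEi : InjOn (fun w : ℂ => E (r * w)) (closedBall 0 1) := by
    intro w hw z hz h
    have := hinj (hrs (real_mul_mem_closedBall hr hw)).2 (hrs (real_mul_mem_closedBall hr hz)).2 h
    exact mul_left_cancel₀ (by exact_mod_cast hr.ne') this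
  have key := image_closedBall_mem_nhds (hcc.comp hEs hmaps) (hinjc.comp hEi hmaps)
  have h2 : ContinuousAt (halfPlaneToComplex ∘ c) (E 0) := hcc.continuousAt hsrc
  simp only [Function.comp_def, mul_zero] at key
  filter_upwards [h2 key, hsrc] with m hm hms
  obtain ⟨w, hw, hwm⟩ := hm
  exact ⟨r * w, (hrs (real_mul_mem_closedBall hr hw)).2, hinjc (hmaps hw) hms hwm⟩

/-- Invariance of domain for maps from the torus to a topological surface. -/
theorem image_mem_nhds_of_torus {M : Type*} [TopologicalSpace M]
    [ChartedSpace (EuclideanHalfSpace 2) M] {W : Set (AddCircle (1 : ℝ) × AddCircle (1 : ℝ))}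
    {E : AddCircle (1 : ℝ) × AddCircle (1 : ℝ) → M} (hE : ContinuousOn E W) (hinj : InjOn E W)
    {p : AddCircle (1 : ℝ) × AddCircle (1 : ℝ)} (hW : W ∈ 𝓝 p) : E '' W ∈ 𝓝 (E p) := by
  obtain ⟨p₁, p₂⟩ := p
  obtain ⟨a, rfl⟩ := QuotientAddGroup.mk_surjective p₁
  obtain ⟨b, rfl⟩ := QuotientAddGroup.mk_surjective p₂
  let θ : ℂ → AddCircle (1 : ℝ) × AddCircle (1 : ℝ) :=
    fun w => (((a + w.re : ℝ) : AddCircle (1 : ℝ)), ((b + w.im : ℝ) : AddCircle (1 : ℝ)))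
  have hθ : Continuous θ := by
    refine ((AddCircle.continuous_mk' 1).comp ?_).prodMk ((AddCircle.continuous_mk' 1).comp ?_)
    all_goals fun_prop
  have hθ0 : θ 0 = ((a : AddCircle (1 : ℝ)), (b : AddCircle (1 : ℝ))) := by simp [θ]
  have hpre : θ ⁻¹' W ∈ 𝓝 0 := hθ.continuousAt (by rw [hθ0]; exact hW)
  obtain ⟨r, hr, hrs⟩ := Metric.nhds_basis_closedBall.mem_iff.1
    (Filter.inter_mem hpre (closedBall_mem_nhds (0 : ℂ) (by norm_num : (0 : ℝ) < 1 / 4)))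
  have hcirc : ∀ x s t : ℝ, |s| ≤ 1 / 4 → |t| ≤ 1 / 4 →
      ((x + s : ℝ) : AddCircle (1 : ℝ)) = ((x + t : ℝ) : AddCircle (1 : ℝ)) → s = t := by
    intro x s t hs ht h
    have hs' := abs_le.1 hs
    have ht' := abs_le.1 ht
    have : Fact (0 < (1 : ℝ)) := ⟨one_pos⟩
    have := (AddCircle.coe_eq_coe_iff_of_mem_Ico (p := (1 : ℝ)) (a := x - 1 / 2)
      ⟨by linarith, by linarith⟩ ⟨by linarith, by linarith⟩).1 h
    linarith
  have hθi : InjOn θ (closedBall 0 (1 / 4)) := by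
    intro w hw z hz h
    rw [mem_closedBall_zero_iff] at hw hz
    refine Complex.ext (hcirc a _ _ ((Complex.abs_re_le_norm _).trans hw)
      ((Complex.abs_re_le_norm _).trans hz) (congrArg Prod.fst h)) (hcirc b _ _
      ((Complex.abs_im_le_norm _).trans hw) ((Complex.abs_im_le_norm _).trans hz)
      (congrArg Prod.snd h))
  have key := image_closedBall_mem_nhds_of_chartedSpace (E := fun w : ℂ => E (θ (r * w)))
    (hE.comp (by fun_prop) fun w hw => (hrs (real_mul_mem_closedBall hr hw)).1) ?_
  · simp only [mul_zero, hθ0] at key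
    refine Filter.mem_of_superset key ?_
    rintro _ ⟨w, hw, rfl⟩
    exact ⟨_, (hrs (real_mul_mem_closedBall hr hw)).1, rfl⟩
  · intro w hw z hz h
    have h1 := hinj (hrs (real_mul_mem_closedBall hr hw)).1 (hrs (real_mul_mem_closedBall hr hz)).1 h
    have h2 := hθi (hrs (real_mul_mem_closedBall hr hw)).2 (hrs (real_mul_mem_closedBall hr hz)).2 h1
    exact mul_left_cancel₀ (by exact_mod_cast hr.ne') h2

/-- Restricted to an open subset of the torus, a continuous injection into a topological surface
is an open embedding. -/
theorem isOpenEmbedding_restrict_of_torus {M : Type*} [TopologicalSpace M]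
    [ChartedSpace (EuclideanHalfSpace 2) M] {W : Set (AddCircle (1 : ℝ) × AddCircle (1 : ℝ))}
    (hW : IsOpen W) {e : W → M} (he : Continuous e) (hinj : Function.Injective e) :
    IsOpenEmbedding e := by
  refine .of_continuous_injective_isOpenMap he hinj ?_
  rcases isEmpty_or_nonempty W with hemp | ⟨⟨w₀⟩⟩
  · exact fun O _ => by simp [Set.eq_empty_of_isEmpty O]
  let E := Function.extend Subtype.val e fun _ => e w₀
  have hEe : ∀ w : W, E w = e w := fun w => Subtype.val_injective.extend_apply _ _ _
  have hrestr : W.domRestrict E = e := funext hEe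
  have hE : ContinuousOn E W := continuousOn_iff_continuous_domRestrict.2 (by rwa [hrestr])
  have hEi : InjOn E W := injOn_iff_injective.2 (by rwa [hrestr])
  intro O hO
  rw [isOpen_iff_mem_nhds]
  rintro _ ⟨w, hw, rfl⟩
  have hO' : Subtype.val '' O ⊆ W := by rintro _ ⟨x, -, rfl⟩; exact x.2
  have := image_mem_nhds_of_torus (hE.mono hO') (hEi.mono hO')
    ((hW.isOpenMap_subtype_val O hO).mem_nhds ⟨w, hw, rfl⟩)
  rw [hEe, image_image] at this
  simpa only [hEe] using this

/-- A continuous function on an open subset which agrees with a global continuous function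
outside a compact set extends continuously. -/
theorem Topology.IsOpenEmbedding.continuous_extend {W M Y : Type*} [TopologicalSpace W]
    [TopologicalSpace M] [T2Space M] [TopologicalSpace Y] {e : W → M} (he : IsOpenEmbedding e)
    {F : W → Y} (hF : Continuous F) {G : M → Y} (hG : Continuous G) {K : Set W}
    (hK : IsCompact K) (hFG : ∀ w ∉ K, F w = G (e w)) : Continuous (Function.extend e F G) := by
  rw [continuous_iff_continuousAt]
  intro m
  by_cases hm : m ∈ range e
  · obtain ⟨w, rfl⟩ := hm
    have hcomp : Function.extend e F G ∘ e = F := funext (he.injective.extend_apply F G)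
    rw [← he.continuousAt_iff, hcomp]
    exact hF.continuousAt
  · have hcl : IsClosed (e '' K) := (hK.image he.continuous).isClosed
    refine hG.continuousAt.congr ?_
    filter_upwards [hcl.isOpen_compl.mem_nhds fun h => hm (image_subset_range _ _ h)] with x hx
    by_cases hxr : x ∈ range e
    · obtain ⟨w, rfl⟩ := hxr
      rw [he.injective.extend_apply]
      exact (hFG w fun h => hx ⟨w, h, rfl⟩).symm
    · rw [Function.extend_apply' _ _ _ hxr]

/-- The extension by the identity of a homeomorphism of an open subset with compact support. -/
def extendHomeomorph {W M : Type*} [TopologicalSpace W] [TopologicalSpace M] [T2Space M]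
    {e : W → M} (he : IsOpenEmbedding e) (g : W ≃ₜ W) {K : Set W} (hK : IsCompact K)
    (hg : ∀ w ∉ K, g w = w) : M ≃ₜ M where
  toFun := Function.extend e (e ∘ g) id
  invFun := Function.extend e (e ∘ g.symm) id
  left_inv m := by
    by_cases hm : ∃ w, e w = m
    · obtain ⟨w, rfl⟩ := hm
      simp [he.injective.extend_apply]
    · simp [Function.extend_apply' _ _ _ hm]
  right_inv m := by
    by_cases hm : ∃ w, e w = m
    · obtain ⟨w, rfl⟩ := hm
      simp [he.injective.extend_apply]
    · simp [Function.extend_apply' _ _ _ hm]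
  continuous_toFun := he.continuous_extend (he.continuous.comp g.continuous) continuous_id hK
    fun w hw => congrArg e (hg w hw)
  continuous_invFun := he.continuous_extend (he.continuous.comp g.symm.continuous) continuous_id hK
    fun w hw => congrArg e (by rw [Homeomorph.symm_apply_eq, hg w hw])

section extendHomeomorph

variable {W M : Type*} [TopologicalSpace W] [TopologicalSpace M] [T2Space M]
    {e : W → M} (he : IsOpenEmbedding e) (g : W ≃ₜ W) {K : Set W} (hK : IsCompact K)
    (hg : ∀ w ∉ K, g w = w)

theorem extendHomeomorph_apply (w : W) : extendHomeomorph he g hK hg (e w) = e (g w) :=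
  he.injective.extend_apply _ _ _

theorem extendHomeomorph_mem_Hc : extendHomeomorph he g hK hg ∈ Hc M := by
  refine (hK.image he.continuous).of_isClosed_subset isClosed_closure
    (closure_minimal (fun m hm => ?_) (hK.image he.continuous).isClosed)
  by_contra hmK
  refine hm ?_
  by_cases hr : ∃ w, e w = m
  · obtain ⟨w, rfl⟩ := hr
    rw [extendHomeomorph_apply, hg w fun h => hmK ⟨w, h, rfl⟩]
  · exact Function.extend_apply' _ _ _ hr

theorem hpow_extendHomeomorph_apply (n : ℕ) (w : W) :
    hpow (extendHomeomorph he g hK hg) n (e w) = e (g^[n] w) := by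
  induction n with
  | zero => rfl
  | succ n ih =>
    rw [Function.iterate_succ_apply', ← extendHomeomorph_apply he g hK hg, ← ih]
    rfl

end extendHomeomorph

/-- A homeomorphism in the identity component changes a circle-valued map only by a
function which lifts to the line. -/
theorem exists_lift_of_mem_H0 {M : Type*} [TopologicalSpace M] {φ : M → AddCircle (1 : ℝ)}
    (hφ : Continuous φ) {f : M ≃ₜ M} (hf : f ∈ H0 M) :
    ∃ u : M → ℝ, Continuous u ∧ ∀ m, (u m : AddCircle (1 : ℝ)) = φ (f m) - φ m := by
  let P : Set (M ≃ₜ M) :=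
    {f | ∃ u : M → ℝ, Continuous u ∧ ∀ m, (u m : AddCircle (1 : ℝ)) = φ (f m) - φ m}
  let N : (M ≃ₜ M) → Set (M ≃ₜ M) := fun f =>
    {g | ∀ m, φ (g m) - φ (f m) ≠ ((-(1 / 2) : ℝ) : AddCircle (1 : ℝ))}
  have hhalf : -((-(1 / 2) : ℝ) : AddCircle (1 : ℝ)) = ((-(1 / 2) : ℝ) : AddCircle (1 : ℝ)) := by
    rw [← AddCircle.coe_neg, ← AddCircle.coe_add_period 1 (-(1 / 2))]
    norm_num
  have hN : ∀ f, N f ∈ 𝓝 f := by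
    intro f
    refine IsOpen.mem_nhds (TopologicalSpace.isOpen_generateFrom_of_mem
      ⟨{q | φ q.2 - φ (f q.1) ≠ ((-(1 / 2) : ℝ) : AddCircle (1 : ℝ))}, ?_, rfl⟩) ?_
    · exact isOpen_ne_fun (by fun_prop) continuous_const
    · intro m h
      rw [sub_self, eq_comm, AddCircle.coe_eq_zero_iff] at h
      obtain ⟨n, hn⟩ := h
      have h2 : (2 * n : ℝ) = -1 := by rw [zsmul_eq_mul] at hn; linarith
      have : 2 * n = -1 := by exact_mod_cast h2
      omega
  have hsymm : ∀ {f g}, g ∈ N f → f ∈ N g := by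
    intro f g h m hm
    refine h m ?_
    rw [← neg_sub, hm, hhalf]
  have : Fact (0 < (1 : ℝ)) := ⟨one_pos⟩
  have hstep : ∀ {f g}, g ∈ N f → f ∈ P → g ∈ P := by
    rintro f g hg ⟨u, hu, hlift⟩
    let c := AddCircle.openPartialHomeomorphCoe (1 : ℝ) (-(1 / 2))
    refine ⟨fun m => u m + c.symm (φ (g m) - φ (f m)), hu.add ?_, fun m => ?_⟩
    · exact c.continuousOn_symm.comp_continuous (by fun_prop) hg
    · have : ((c.symm (φ (g m) - φ (f m)) : ℝ) : AddCircle (1 : ℝ)) = φ (g m) - φ (f m) :=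
        c.right_inv (hg m)
      rw [AddCircle.coe_add, this, hlift]
      abel
  have hP : IsClopen P := by
    refine ⟨?_, ?_⟩
    · rw [← isOpen_compl_iff, isOpen_iff_mem_nhds]
      intro f hf
      filter_upwards [hN f] with g hg hgP
      exact hf (hstep (hsymm hg) hgP)
    · rw [isOpen_iff_mem_nhds]
      intro f hf
      filter_upwards [hN f] with g hg
      exact hstep hg hf
  refine hP.connectedComponent_subset ⟨fun _ => 0, continuous_const, fun m => ?_⟩ hf
  simp

/-- The real ramp, equal to `0` on the left and to `1` on the right of the interval
`[3/8, 5/8]`. -/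
def ramp (s : ℝ) : ℝ := max 0 (min 1 (4 * s - 3 / 2))

/-- The lift to the line of the degree one self-map of the circle which is constant outside the
arc `[3/8, 5/8]`. -/
def pinchLift (s : ℝ) : ℝ := s + (ramp (Int.fract s) - Int.fract s)

theorem ramp_zero : ramp 0 = 0 := by norm_num [ramp]

theorem ramp_one : ramp 1 = 1 := by norm_num [ramp]

theorem continuous_ramp : Continuous ramp := by unfold ramp; fun_prop

theorem continuous_pinchLift : Continuous pinchLift := by
  have h := ContinuousOn.comp_fract'' (f := fun s : ℝ => ramp s - s)
    (continuous_ramp.sub continuous_id).continuousOn (by simp [ramp_zero, ramp_one])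
  exact continuous_id.add h

theorem pinchLift_add_one (s : ℝ) : pinchLift (s + 1) = pinchLift s + 1 := by
  simp only [pinchLift, Int.fract_add_one]
  ring

theorem pinchLift_add_nat (s : ℝ) (n : ℕ) : pinchLift (s + n) = pinchLift s + n := by
  induction n with
  | zero => simp
  | succ n ih =>
    push_cast
    rw [← add_assoc, pinchLift_add_one, ih, add_assoc]

theorem pinchLift_eq_zero {s : ℝ} (hs : |s| ≤ 3 / 8) : pinchLift s = 0 := by
  have hs' := abs_le.1 hs
  unfold pinchLift
  rcases le_or_gt 0 s with h | h
  · rw [Int.fract_eq_self.2 ⟨h, by linarith⟩, ramp, min_eq_right (by linarith),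
      max_eq_left (by linarith)]
    ring
  · have hf : Int.fract s = s + 1 := by
      rw [← Int.fract_add_one]
      exact Int.fract_eq_self.2 ⟨by linarith, by linarith⟩
    rw [hf, ramp, min_eq_left (by linarith), max_eq_right (by linarith)]
    ring

/-- The degree one self-map of the circle which is constant outside the arc `[3/8, 5/8]`. -/
def pinch : AddCircle (1 : ℝ) → AddCircle (1 : ℝ) :=
  Function.Periodic.lift (f := fun s : ℝ => (pinchLift s : AddCircle (1 : ℝ))) (c := 1) fun s => by
    simp only [pinchLift_add_one, AddCircle.coe_add_period]

theorem pinch_coe (s : ℝ) : pinch (s : AddCircle (1 : ℝ)) = (pinchLift s : AddCircle (1 : ℝ)) :=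
  rfl

theorem continuous_pinch : Continuous pinch :=
  continuous_coinduced_dom.2 ((AddCircle.continuous_mk' 1).comp continuous_pinchLift)

theorem pinch_eq_zero {x : AddCircle (1 : ℝ)} (hx : ‖x‖ ≤ 3 / 8) : pinch x = 0 := by
  obtain ⟨s, rfl⟩ := QuotientAddGroup.mk_surjective x
  have hs : ((s - round s : ℝ) : AddCircle (1 : ℝ)) = s := by
    rw [AddCircle.coe_sub, sub_eq_self, AddCircle.coe_eq_zero_iff]
    exact ⟨round s, by simp⟩
  have hn := AddCircle.norm_eq (1 : ℝ) (x := s)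
  rw [inv_one, one_mul, mul_one] at hn
  change pinch (s : AddCircle (1 : ℝ)) = 0
  rw [← hs, pinch_coe, pinchLift_eq_zero (hn ▸ hx), AddCircle.coe_zero]

/-- The union of a vertical and a horizontal open band in the torus, away from the removed disk. -/
def crossBands : Set (AddCircle (1 : ℝ) × AddCircle (1 : ℝ)) :=
  {p | 1 / 4 < ‖p.1‖ ∨ 1 / 4 < ‖p.2‖}

theorem isOpen_crossBands : IsOpen crossBands :=
  (isOpen_lt continuous_const continuous_fst.norm).union
    (isOpen_lt continuous_const continuous_snd.norm)

theorem notMem_torusDisk_of_mem_crossBands {p : Torus} (hp : p ∈ crossBands) :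
    p ∉ torusDisk := by
  rintro ⟨q, hq, rfl⟩
  rw [mem_ball_zero_iff] at hq
  have hle : ∀ i, ‖((q i : ℝ) : AddCircle (1 : ℝ))‖ < 1 / 4 := fun i => by
    refine lt_of_le_of_lt ?_ hq
    exact (QuotientAddGroup.norm_mk_le_norm).trans (PiLp.norm_apply_le q i)
  rcases hp with h | h
  · exact (hle 0).not_gt h
  · exact (hle 1).not_gt h

theorem isCompact_preimage_crossBands {K : Set (AddCircle (1 : ℝ) × AddCircle (1 : ℝ))}
    (hK : IsClosed K) (hsub : K ⊆ crossBands) :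
    IsCompact (Subtype.val ⁻¹' K : Set crossBands) := by
  have : Fact (0 < (1 : ℝ)) := ⟨one_pos⟩
  exact IsInducing.subtypeVal.isCompact_preimage_iff (by simpa using hsub) |>.2 hK.isCompact

/-- The shear of the torus along the vertical band, by a given rotation-valued function. -/
def shearMap (τ : AddCircle (1 : ℝ) → AddCircle (1 : ℝ)) (hτ : ∀ x, ‖x‖ ≤ 3 / 8 → τ x = 0)
    (w : crossBands) : crossBands :=
  ⟨(w.1.1, w.1.2 + τ w.1.1), by
    by_cases h : ‖w.1.1‖ ≤ 3 / 8
    · rw [hτ _ h, add_zero]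
      exact w.2
    · exact Or.inl (by linarith)⟩

/-- The Dehn twist along the vertical band. -/
def bandTwist : crossBands ≃ₜ crossBands where
  toFun := shearMap pinch fun _ => pinch_eq_zero
  invFun := shearMap (fun x => -pinch x) fun _ h => by rw [pinch_eq_zero h, neg_zero]
  left_inv w := by simp [shearMap]
  right_inv w := by simp [shearMap]
  continuous_toFun := by
    have := continuous_pinch
    exact Continuous.subtype_mk (by fun_prop) _
  continuous_invFun := by
    have := continuous_pinch
    exact Continuous.subtype_mk (by fun_prop) _

theorem bandTwist_coe (w : crossBands) :
    (bandTwist w : AddCircle (1 : ℝ) × AddCircle (1 : ℝ)) = (w.1.1, w.1.2 + pinch w.1.1) :=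
  rfl

theorem bandTwist_iterate_coe (n : ℕ) (w : crossBands) :
    (bandTwist^[n] w : AddCircle (1 : ℝ) × AddCircle (1 : ℝ)) =
      (w.1.1, w.1.2 + n • pinch w.1.1) := by
  induction n with
  | zero => simp
  | succ n ih => rw [Function.iterate_succ_apply', bandTwist_coe, ih, succ_nsmul, add_assoc]

/-- The horizontal loop through `(0, 1/2)`. -/
def crossLoop (s : ℝ) : crossBands :=
  ⟨((s : AddCircle (1 : ℝ)), ((1 / 2 : ℝ) : AddCircle (1 : ℝ))), Or.inr (by
    have := AddCircle.norm_half_period_eq (1 : ℝ)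
    rw [this]
    norm_num)⟩

theorem continuous_crossLoop : Continuous crossLoop := by
  have := AddCircle.continuous_mk' (1 : ℝ)
  exact Continuous.subtype_mk (this.prodMk continuous_const) _

theorem crossLoop_one : crossLoop 1 = crossLoop 0 := by
  simp only [crossLoop, AddCircle.coe_period, AddCircle.coe_zero]

/-- Two continuous lifts to the line of the same circle-valued path have the same increments. -/
theorem sub_eq_sub_of_coe_eq {u v : ℝ → ℝ} (hu : Continuous u) (hv : Continuous v)
    (c : AddCircle (1 : ℝ)) (h : ∀ s, (u s : AddCircle (1 : ℝ)) = (v s : AddCircle (1 : ℝ)) - c)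
    (s t : ℝ) : u s - u t = v s - v t := by
  have hk : ∀ s, ∃ k : ℤ, (k : ℝ) = (u s - v s) - (u 0 - v 0) := by
    intro s
    have : (((u s - v s) - (u 0 - v 0) : ℝ) : AddCircle (1 : ℝ)) = 0 := by
      simp only [AddCircle.coe_sub, h]
      abel
    obtain ⟨k, hk⟩ := (AddCircle.coe_eq_zero_iff _).1 this
    exact ⟨k, by simpa using hk⟩
  choose k hk using hk
  have hkc : Continuous k := by
    rw [Int.isClosedEmbedding_coe_real.isInducing.continuous_iff]
    have : ((fun n : ℤ => (n : ℝ)) ∘ k) = fun s => (u s - v s) - (u 0 - v 0) := funext hk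
    rw [this]
    fun_prop
  have h1 : k s = k t := PreconnectedSpace.constant inferInstance hkc
  have := hk s
  rw [h1, hk t] at this
  linarith

variable (M : Type*) [TopologicalSpace M] [T2Space M] [SigmaCompactSpace M]
  [ChartedSpace (EuclideanHalfSpace 2) M] [ConnectedSpace M]

/-- If a σ-compact non-compact connected 2-manifold `M` contains a handle (a compact
subsurface homeomorphic to the torus with an open disk removed), then the mapping class
group `𝓜_c(M) = 𝓗_c(M)/𝓗₀(M)` contains an element of infinite order. -/
theorem mcg_infinite_order_of_handle (hnc : ¬ CompactSpace M)
    (S : Set M) (hS : IsCompact S) (hhandle : Nonempty (↥S ≃ₜ TorusWithHole)) :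
    ∃ h ∈ Hc M, ∀ n : ℕ, 0 < n → hpow h n ∉ H0 M := by
  obtain ⟨ψ⟩ := hhandle
  let i : crossBands → TorusWithHole := fun w => ⟨w.1, notMem_torusDisk_of_mem_crossBands w.2⟩
  have hi : Continuous i := Continuous.subtype_mk continuous_subtype_val _
  have hinj : Function.Injective i := fun w z h => Subtype.ext (Subtype.mk.inj h)
  have he : IsOpenEmbedding fun w => (ψ.symm (i w) : M) :=
    isOpenEmbedding_restrict_of_torus isOpen_crossBands
      (continuous_subtype_val.comp (ψ.symm.continuous.comp hi))
      (Subtype.val_injective.comp (ψ.symm.injective.comp hinj))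
  set e : crossBands → M := fun w => (ψ.symm (i w) : M)
  have hK₁ := isCompact_preimage_crossBands (K := {p | 3 / 8 ≤ ‖p.1‖})
    (isClosed_le continuous_const (by fun_prop)) fun p hp => Or.inl (by
      have : 3 / 8 ≤ ‖p.1‖ := hp
      linarith)
  have hK₂ := isCompact_preimage_crossBands (K := {p | 3 / 8 ≤ ‖p.2‖})
    (isClosed_le continuous_const (by fun_prop)) fun p hp => Or.inr (by
      have : 3 / 8 ≤ ‖p.2‖ := hp
      linarith)
  have hg : ∀ w ∉ (Subtype.val ⁻¹' {p | 3 / 8 ≤ ‖p.1‖} : Set crossBands), bandTwist w = w := by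
    intro w hw
    refine Subtype.ext ?_
    rw [bandTwist_coe, pinch_eq_zero (not_le.1 hw).le, add_zero]
  let F : crossBands → AddCircle (1 : ℝ) := fun w => pinch w.1.2
  have hF : Continuous F := continuous_pinch.comp (by fun_prop)
  let φ : M → AddCircle (1 : ℝ) := Function.extend e F fun _ => 0
  have hφ : Continuous φ := he.continuous_extend hF continuous_const hK₂
    fun w hw => pinch_eq_zero (not_le.1 hw).le
  have hφe : ∀ w, φ (e w) = pinch w.1.2 := he.injective.extend_apply _ _
  refine ⟨extendHomeomorph he bandTwist hK₁ hg, extendHomeomorph_mem_Hc he _ hK₁ hg,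
    fun n hn hmem => ?_⟩
  obtain ⟨u, hu, hlift⟩ := exists_lift_of_mem_H0 hφ hmem
  have key := sub_eq_sub_of_coe_eq (u := fun s => u (e (crossLoop s)))
    (v := fun s => pinchLift (1 / 2 + n * pinchLift s))
    (hu.comp (he.continuous.comp continuous_crossLoop))
    (continuous_pinchLift.comp (by have := continuous_pinchLift; fun_prop))
    (pinch ((1 / 2 : ℝ) : AddCircle (1 : ℝ))) (fun s => by
      rw [hlift, hpow_extendHomeomorph_apply, hφe, hφe, bandTwist_iterate_coe, ← pinch_coe,
        AddCircle.coe_add, ← nsmul_eq_mul, AddCircle.coe_nsmul, ← pinch_coe]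
      rfl) 1 0
  have h0 : pinchLift 0 = 0 := pinchLift_eq_zero (by norm_num)
  have h1 : pinchLift 1 = 1 := by
    have := pinchLift_add_one 0
    rwa [zero_add, h0, zero_add] at this
  simp only [crossLoop_one, sub_self, h0, h1, mul_one, mul_zero, add_zero,
    pinchLift_add_nat, add_sub_cancel_left] at key
  exact hn.ne (by exact_mod_cast key)

end
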